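/- Let α ∈ IOF_n^par with domain d₁ < ... < d_{n−2} and images m₁ < ... < m_{n−2} (rank n−2). Then d_k − d_{k−1} = m_k − m_{k−1} for all k ∈ {2,...,n−2}. -/

import Mathlib

/-- A partial injection on `{1,...,n}`, represented by its graph. -/
structure PInj (n : ℕ) where
  R : ℕ → ℕ → Prop
  memL : ∀ ⦃x y⦄, R x y → x ∈ Set.Icc 1 n
  memR : ∀ ⦃x y⦄, R x y → y ∈ Set.Icc 1 n
  func : ∀ ⦃x y y'⦄, R x y → R x y' → y = y'
  inj : ∀ ⦃x x' y⦄, R x y → R x' y → x = x'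

namespace PInj

variable {n : ℕ}

@[ext] theorem ext {a b : PInj n} (h : ∀ x y, a.R x y ↔ b.R x y) : a = b := by
  cases a; cases b
  simp only [mk.injEq]
  funext x y
  exact propext (h x y)

instance : Mul (PInj n) :=
  ⟨fun a b =>
    { R := fun x z => ∃ y, a.R x y ∧ b.R y z
      memL := by rintro x z ⟨y, h1, _⟩; exact a.memL h1
      memR := by rintro x z ⟨y, _, h2⟩; exact b.memR h2
      func := by
        rintro x z z' ⟨y, h1, h2⟩ ⟨y', h1', h2'⟩
        obtain rfl := a.func h1 h1'
        exact b.func h2 h2'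
      inj := by
        rintro x x' z ⟨y, h1, h2⟩ ⟨y', h1', h2'⟩
        obtain rfl := b.inj h2 h2'
        exact a.inj h1 h1' }⟩

instance : One (PInj n) :=
  ⟨{ R := fun x y => x ∈ Set.Icc 1 n ∧ y = x
     memL := by rintro x y ⟨h, rfl⟩; exact h
     memR := by rintro x y ⟨h, rfl⟩; exact h
     func := by rintro x y y' ⟨_, rfl⟩ ⟨_, rfl⟩; rfl
     inj := by rintro x x' y ⟨_, rfl⟩ ⟨_, h⟩; exact h }⟩

instance : Monoid (PInj n) where
  mul_assoc a b c := by
    ext x y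
    constructor
    · rintro ⟨z, ⟨w, h1, h2⟩, h3⟩; exact ⟨w, h1, z, h2, h3⟩
    · rintro ⟨w, h1, z, h2, h3⟩; exact ⟨z, ⟨w, h1, h2⟩, h3⟩
  one_mul a := by
    ext x y
    constructor
    · rintro ⟨z, ⟨_, rfl⟩, h⟩; exact h
    · intro h; exact ⟨x, ⟨a.memL h, rfl⟩, h⟩
  mul_one a := by
    ext x y
    constructor
    · rintro ⟨z, h, _, rfl⟩; exact h
    · intro h; exact ⟨y, h, a.memR h, rfl⟩

/-- The inverse of a partial injection. -/
def inv (a : PInj n) : PInj n where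
  R := fun x y => a.R y x
  memL := by intro x y h; exact a.memR h
  memR := by intro x y h; exact a.memL h
  func := by intro x y y' h h'; exact a.inj h h'
  inj := by intro x x' y h h'; exact a.func h h'

/-- The domain of a partial injection. -/
def dom (a : PInj n) : Set ℕ := {x | ∃ y, a.R x y}

/-- The image of a partial injection. -/
def im (a : PInj n) : Set ℕ := {y | ∃ x, a.R x y}

end PInj

/-- The strict fence (zig-zag) order on `{1,...,n}`: `x ≺ y` iff `x` is odd and
`x`, `y` are adjacent.  It is generated by `i ≺ i+1` for odd `i` and `i+1 ≺ i`
for even `i`. -/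
def FenceLt (x y : ℕ) : Prop := Odd x ∧ (y = x + 1 ∨ x = y + 1)

/-- Membership in `IOF_n^par`: order-preserving, parity-preserving,
fence-preserving, and with fence-preserving inverse. -/
def IsIOF {n : ℕ} (a : PInj n) : Prop :=
  (∀ ⦃x y x' y'⦄, a.R x y → a.R x' y' → x < x' → y < y') ∧
  (∀ ⦃x y⦄, a.R x y → x % 2 = y % 2) ∧
  (∀ ⦃x y x' y'⦄, a.R x y → a.R x' y' → FenceLt x x' → FenceLt y y') ∧
  (∀ ⦃x y x' y'⦄, a.R x y → a.R x' y' → FenceLt y y' → FenceLt x x')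

/-- A partial identity: every point of the domain is fixed. -/
def IsPartialId {n : ℕ} (a : PInj n) : Prop := ∀ ⦃x y⦄, a.R x y → y = x

/-- The partial identity `v_i` with domain `{1,...,n} \ {i}`. -/
def vMap (n i : ℕ) : PInj n where
  R := fun x y => x ∈ Set.Icc 1 n ∧ x ≠ i ∧ y = x
  memL := by rintro x y ⟨h, _, rfl⟩; exact h
  memR := by rintro x y ⟨h, _, rfl⟩; exact h
  func := by rintro x y y' ⟨_, _, rfl⟩ ⟨_, _, rfl⟩; rfl
  inj := by rintro x x' y ⟨_, _, rfl⟩ ⟨_, _, h⟩; exact h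

/-- The map `u_i` with domain `{1,...,i} ∪ {i+4,...,n}`, sending `ρ ↦ ρ+2` for
`ρ ≤ i` and `ρ ↦ ρ` for `ρ ≥ i+4`. -/
def uMap (n i : ℕ) : PInj n where
  R := fun x y => x ∈ Set.Icc 1 n ∧ y ∈ Set.Icc 1 n ∧
        ((x ≤ i ∧ y = x + 2) ∨ (i + 4 ≤ x ∧ y = x))
  memL := by rintro x y ⟨h, _, _⟩; exact h
  memR := by rintro x y ⟨_, h, _⟩; exact h
  func := by
    rintro x y y' ⟨_, _, (⟨hx, rfl⟩ | ⟨hx, rfl⟩)⟩ ⟨_, _, (⟨hx', rfl⟩ | ⟨hx', rfl⟩)⟩ <;> omega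
  inj := by
    rintro x x' y ⟨_, _, (⟨hx, rfl⟩ | ⟨hx, rfl⟩)⟩ ⟨_, _, (⟨hx', h'⟩ | ⟨hx', h'⟩)⟩ <;> omega

/-- The set `J_i = {1,...,i} ∪ {i+4,...,n}`. -/
def Jset (n i : ℕ) : Set ℕ := {x | (1 ≤ x ∧ x ≤ i) ∨ (i + 4 ≤ x ∧ x ≤ n)}

/-- `G` is a generating set of the monoid `IOF_n^par`: it consists of elements of
`IOF_n^par` and every element of `IOF_n^par` is a finite product of elements of `G`. -/
def Generates (n : ℕ) (G : Set (PInj n)) : Prop :=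
  (∀ g ∈ G, IsIOF g) ∧
  ∀ a : PInj n, IsIOF a →
    ∃ l : List (PInj n), (∀ b ∈ l, b ∈ G) ∧ l.prod = a

theorem Fin.add_le_add_of_strictMono {p : ℕ} {f : Fin p → ℕ} (hf : StrictMono f) (i : Fin p)
    (t : ℕ) (h : i.val + t < p) : f i + t ≤ f ⟨i.val + t, h⟩ := by
  induction t with
  | zero => exact le_rfl
  | succ t ih =>
    have h₁ := ih (by omega)
    have h₂ : f ⟨i.val + t, by omega⟩ < f ⟨i.val + (t + 1), h⟩ := hf (Fin.mk_lt_mk.2 (by omega))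
    omega

theorem Fin.gap_le_of_strictMono {n : ℕ} {f : Fin (n - 2) → ℕ} (hf : StrictMono f)
    (hmem : ∀ k, f k ∈ Set.Icc 1 n) (k : Fin (n - 2)) (h : k.val + 1 < n - 2) :
    f ⟨k.val + 1, h⟩ ≤ f k + 3 := by
  have hlow := Fin.add_le_add_of_strictMono hf ⟨0, by omega⟩ k.val (by simp)
  have hhigh := Fin.add_le_add_of_strictMono hf ⟨k.val + 1, h⟩ (n - 4 - k.val)
    (by simp only; omega)
  have h₁ := (hmem ⟨0, by omega⟩).1
  have h₂ := (hmem ⟨k.val + 1 + (n - 4 - k.val), by omega⟩).2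
  simp only [zero_add, Fin.eta] at hlow hhigh
  omega

theorem IsIOF.eq_succ_iff {n : ℕ} {a : PInj n} (ha : IsIOF a) {x y x' y' : ℕ} (h : a.R x y)
    (h' : a.R x' y') (hx : x < x') : x' = x + 1 ↔ y' = y + 1 := by
  obtain ⟨hord, -, hf, hf'⟩ := ha
  have hy := hord h h' hx
  have h₁ := hf h h'
  have h₂ := hf h' h
  have h₃ := hf' h h'
  have h₄ := hf' h' h
  simp only [FenceLt, Nat.odd_iff] at h₁ h₂ h₃ h₄
  omega

/-- for `α ∈ IOF_n^par` of rank `n-2`, successive gaps in the domain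
equal the corresponding gaps in the image. -/
theorem stmt9 (n : ℕ) (hn : 4 ≤ n) (a : PInj n) (ha : IsIOF a)
    (d m : Fin (n - 2) → ℕ) (hd : StrictMono d)
    (hdom : ∀ x y, a.R x y → ∃ k, d k = x)
    (hm : ∀ k, a.R (d k) (m k)) :
    ∀ k : Fin (n - 2), ∀ h : k.val + 1 < n - 2,
      d ⟨k.val + 1, h⟩ - d k = m ⟨k.val + 1, h⟩ - m k := by
  intro k h
  have hlt : ∀ i j, i < j → m i < m j := fun i j hij => ha.1 (hm i) (hm j) (hd hij)
  have hk : k < ⟨k.val + 1, h⟩ := Fin.lt_def.2 (Nat.lt_succ_self _)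
  have hdk := hd hk
  have hmk := hlt _ _ hk
  have hdgap := Fin.gap_le_of_strictMono hd (fun i => a.memL (hm i)) k h
  have hmgap := Fin.gap_le_of_strictMono (fun i j => hlt i j) (fun i => a.memR (hm i)) k h
  have hsucc := ha.eq_succ_iff (hm k) (hm ⟨k.val + 1, h⟩) hdk
  have hpar := ha.2.1 (hm k)
  have hpar' := ha.2.1 (hm ⟨k.val + 1, h⟩)
  omega
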